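/- Let V be a weak-* closed linear subspace of 𝒮'_n, let E : 𝒮_n → 𝒮_m be a continuous linear operator which is the associated operator of an 𝒮-basis e of V, i.e. the map ᵗE : 𝒮'_m → 𝒮'_n, a ↦ a ∘ E, is injective and has range equal to V, and let f : ℝ^m → ℂ be a slowly increasing smooth function with multiplication operator M_f on 𝒮_m. Then the product family fe is an 𝒮-basis of V (i.e. the map a ↦ a ∘ (M_f ∘ E) is injective with range equal to V) if and only if f is an invertible element of the ring of slowly increasing smooth functions, i.e. f(x) ≠ 0 for every x ∈ ℝ^m and the pointwise reciprocal 1/f is also slowly increasing. -/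

import Mathlib

open SchwartzMap

/-- The partial derivative of `f : ℝ^m → ℂ` in the `i`-th coordinate direction. -/
noncomputable def pDeriv {m : ℕ} (i : Fin m) (f : (Fin m → ℝ) → ℂ) : (Fin m → ℝ) → ℂ :=
  fun x => fderiv ℝ f x (Pi.single i 1)

/-- The multi-index partial derivative `∂^α f` of `f : ℝ^m → ℂ`. -/
noncomputable def multiDeriv {m : ℕ} (α : Fin m → ℕ) (f : (Fin m → ℝ) → ℂ) :
    (Fin m → ℝ) → ℂ :=
  (List.finRange m).foldr (fun i g => (pDeriv i)^[α i] g) f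

/-- A function `f : ℝ^m → ℂ` is slowly increasing (of class `𝒪_M`) if it is smooth and
every multi-index derivative `∂^α f` is bounded in absolute value by a polynomial. -/
def SlowlyIncreasing {m : ℕ} (f : (Fin m → ℝ) → ℂ) : Prop :=
  ContDiff ℝ (⊤ : ℕ∞) f ∧ ∀ α : Fin m → ℕ, ∃ P : MvPolynomial (Fin m) ℝ,
    ∀ x : Fin m → ℝ, ‖multiDeriv α f x‖ ≤ |MvPolynomial.eval x P|

open Function

section Derivatives

variable {m : ℕ}

lemma contDiff_pDeriv {f : (Fin m → ℝ) → ℂ} (hf : ContDiff ℝ (⊤ : ℕ∞) f) (i : Fin m) :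
    ContDiff ℝ (⊤ : ℕ∞) (pDeriv i f) :=
  (hf.fderiv_right (m := (⊤ : ℕ∞)) (by simp)).clm_apply contDiff_const

lemma contDiff_iterate_pDeriv {f : (Fin m → ℝ) → ℂ} (hf : ContDiff ℝ (⊤ : ℕ∞) f) (i : Fin m)
    (k : ℕ) : ContDiff ℝ (⊤ : ℕ∞) ((pDeriv i)^[k] f) :=
  Function.Iterate.rec (fun g => ContDiff ℝ (⊤ : ℕ∞) g) hf (fun _ hg => contDiff_pDeriv hg i) k

lemma pDeriv_comm {f : (Fin m → ℝ) → ℂ} (hf : ContDiff ℝ (⊤ : ℕ∞) f) (i j : Fin m) :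
    pDeriv i (pDeriv j f) = pDeriv j (pDeriv i f) := by
  have hdiff : Differentiable ℝ (fderiv ℝ f) :=
    (hf.fderiv_right (m := (⊤ : ℕ∞)) (by simp)).differentiable (by simp)
  have key (u v : Fin m → ℝ) (x : Fin m → ℝ) :
      fderiv ℝ (fun y => fderiv ℝ f y v) x u = fderiv ℝ (fderiv ℝ f) x u v := by
    rw [fderiv_clm_apply (hdiff x) (differentiableAt_const v)]
    simp
  ext x
  refine (key _ _ x).trans (Eq.trans ?_ (key _ _ x).symm)
  exact hf.contDiffAt.isSymmSndFDerivAt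
    (by simpa using WithTop.coe_le_coe.2 (le_top : (2 : ℕ∞) ≤ ⊤)) _ _

lemma pDeriv_iterate_comm {f : (Fin m → ℝ) → ℂ} (hf : ContDiff ℝ (⊤ : ℕ∞) f) (i j : Fin m)
    (k : ℕ) : (pDeriv j)^[k] (pDeriv i f) = pDeriv i ((pDeriv j)^[k] f) := by
  induction k with
  | zero => rfl
  | succ k ih =>
    rw [iterate_succ_apply', iterate_succ_apply', ih,
      pDeriv_comm (contDiff_iterate_pDeriv hf j k)]

/-- A property stable under all partial derivatives passes to all multi-index derivatives. -/
lemma foldr_pDeriv_induction {p : ((Fin m → ℝ) → ℂ) → Prop} (hp : ∀ i g, p g → p (pDeriv i g))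
    {f : (Fin m → ℝ) → ℂ} (hf : p f) (α : Fin m → ℕ) (l : List (Fin m)) :
    p (l.foldr (fun i g => (pDeriv i)^[α i] g) f) := by
  induction l with
  | nil => exact hf
  | cons i l ih => exact Function.Iterate.rec p ih (hp i) (α i)

lemma foldr_pDeriv_comm {f : (Fin m → ℝ) → ℂ} (hf : ContDiff ℝ (⊤ : ℕ∞) f) (i : Fin m)
    (α : Fin m → ℕ) (l : List (Fin m)) :
    l.foldr (fun j g => (pDeriv j)^[α j] g) (pDeriv i f) =
      pDeriv i (l.foldr (fun j g => (pDeriv j)^[α j] g) f) := by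
  induction l with
  | nil => rfl
  | cons j l ih =>
    rw [List.foldr_cons, List.foldr_cons, ih, pDeriv_iterate_comm]
    exact foldr_pDeriv_induction (p := fun g => ContDiff ℝ (⊤ : ℕ∞) g)
      (fun i g hg => contDiff_pDeriv hg i) hf α l

lemma foldr_pDeriv_pDeriv {f : (Fin m → ℝ) → ℂ} (hf : ContDiff ℝ (⊤ : ℕ∞) f) (i : Fin m)
    (α : Fin m → ℕ) {l : List (Fin m)} (hl : l.Nodup) (hi : i ∈ l) :
    l.foldr (fun j g => (pDeriv j)^[α j] g) (pDeriv i f) =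
      l.foldr (fun j g => (pDeriv j)^[(α + Pi.single i 1 : Fin m → ℕ) j] g) f := by
  induction l with
  | nil => simp at hi
  | cons j l ih =>
    obtain ⟨hjl, hl⟩ := List.nodup_cons.1 hl
    rw [List.foldr_cons, List.foldr_cons]
    rcases eq_or_ne i j with rfl | hij
    · rw [foldr_pDeriv_comm hf, Pi.add_apply, Pi.single_eq_same, iterate_succ_apply]
      congr 2
      refine List.foldr_ext _ _ _ fun k hk g => ?_
      have hki : k ≠ i := by rintro rfl; exact hjl hk
      simp [hki]
    · rw [ih hl (List.mem_of_ne_of_mem hij hi)]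
      simp [hij.symm]

lemma multiDeriv_pDeriv {f : (Fin m → ℝ) → ℂ} (hf : ContDiff ℝ (⊤ : ℕ∞) f) (i : Fin m)
    (α : Fin m → ℕ) : multiDeriv α (pDeriv i f) = multiDeriv (α + Pi.single i 1) f :=
  foldr_pDeriv_pDeriv hf i α (List.nodup_finRange m) (List.mem_finRange i)

lemma multiDeriv_zero (f : (Fin m → ℝ) → ℂ) : multiDeriv 0 f = f := by
  simp only [multiDeriv, Pi.zero_apply, iterate_zero_apply]
  induction List.finRange m with
  | nil => rfl
  | cons i l ih => simp

lemma SlowlyIncreasing.pDeriv {f : (Fin m → ℝ) → ℂ} (hf : SlowlyIncreasing f) (i : Fin m) :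
    SlowlyIncreasing (pDeriv i f) :=
  ⟨contDiff_pDeriv hf.1 i, fun α => by rw [multiDeriv_pDeriv hf.1]; exact hf.2 _⟩

end Derivatives

section Growth

variable {m : ℕ}

lemma MvPolynomial.hasTemperateGrowth_eval (P : MvPolynomial (Fin m) ℝ) :
    HasTemperateGrowth (fun x : Fin m → ℝ => MvPolynomial.eval x P) := by
  induction P using MvPolynomial.induction_on with
  | C a => simp
  | add p q hp hq => simpa using! hp.add hq
  | mul_X p i hp =>
    simpa using! hp.mul (ContinuousLinearMap.proj (R := ℝ) (φ := fun _ : Fin m => ℝ)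
      i).hasTemperateGrowth

/-- Powers of `1 + ‖x‖` are dominated by polynomials. -/
lemma exists_mvPolynomial_bound (k : ℕ) (C : ℝ) : ∃ P : MvPolynomial (Fin m) ℝ,
    ∀ x : Fin m → ℝ, C * (1 + ‖x‖) ^ k ≤ |MvPolynomial.eval x P| := by
  refine ⟨MvPolynomial.C C *
    (MvPolynomial.C 2 + ∑ i, MvPolynomial.X i ^ 2) ^ k, fun x => ?_⟩
  have hx : ‖x‖ ≤ 1 + ∑ i, x i ^ 2 := by
    refine (pi_norm_le_iff_of_nonneg (by positivity)).2 fun i => ?_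
    have := Finset.single_le_sum (f := fun i => x i ^ 2) (fun i _ => sq_nonneg (x i))
      (Finset.mem_univ i)
    rw [Real.norm_eq_abs, abs_le]
    constructor <;> nlinarith [sq_nonneg (x i - 1), sq_nonneg (x i + 1)]
  simp only [map_mul, MvPolynomial.eval_C, map_pow, map_add, map_sum, MvPolynomial.eval_X, abs_mul,
    abs_pow]
  rw [abs_of_nonneg (by positivity : (0 : ℝ) ≤ 2 + ∑ i, x i ^ 2)]
  gcongr ?_ * ?_ ^ k
  · exact le_abs_self C
  · linarith

lemma SlowlyIncreasing.exists_norm_iteratedFDeriv_le (n : ℕ) :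
    ∀ {f : (Fin m → ℝ) → ℂ}, SlowlyIncreasing f → ∃ (k : ℕ) (C : ℝ),
      ∀ x, ‖iteratedFDeriv ℝ n f x‖ ≤ C * (1 + ‖x‖) ^ k := by
  induction n with
  | zero =>
    intro f hf
    obtain ⟨P, hP⟩ := hf.2 0
    obtain ⟨k, C, h⟩ := P.hasTemperateGrowth_eval.2 0
    refine ⟨k, C, fun x => ?_⟩
    simpa using (multiDeriv_zero f ▸ hP x).trans (by simpa using h x)
  | succ n ih =>
    intro f hf
    choose k C h using fun i => ih (hf.pDeriv i)
    let L (i : Fin m) : ℂ →L[ℝ] (Fin m → ℝ) →L[ℝ] ℂ :=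
      ContinuousLinearMap.smulRightL ℝ (Fin m → ℝ) ℂ
        (ContinuousLinearMap.proj (R := ℝ) (φ := fun _ : Fin m => ℝ) i)
    have hfd : fderiv ℝ f = ∑ i, L i ∘ _root_.pDeriv i f := by
      ext x v
      conv_lhs => rw [pi_eq_sum_univ' v]
      simp [L, _root_.pDeriv, Finset.sum_apply]
    refine ⟨Finset.univ.sup k, ∑ i, ‖L i‖ * |C i|, fun x => ?_⟩
    rw [← norm_iteratedFDeriv_fderiv, hfd, iteratedFDeriv_sum_apply fun i _ =>
      ((L i).contDiff.comp ((hf.pDeriv i).1.of_le (mod_cast le_top))).contDiffAt, Finset.sum_mul]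
    refine norm_sum_le_of_le _ fun i _ => ?_
    refine ((L i).norm_iteratedFDeriv_comp_left (hf.pDeriv i).1.contDiffAt
      (mod_cast le_top)).trans ?_
    rw [mul_assoc]
    gcongr
    refine (h i x).trans ?_
    gcongr
    · exact le_abs_self _
    · simp
    · exact Finset.le_sup (Finset.mem_univ i)

lemma SlowlyIncreasing.hasTemperateGrowth {f : (Fin m → ℝ) → ℂ} (hf : SlowlyIncreasing f) :
    HasTemperateGrowth f :=
  ⟨hf.1, fun n => hf.exists_norm_iteratedFDeriv_le n⟩

lemma Function.HasTemperateGrowth.pDeriv {f : (Fin m → ℝ) → ℂ} (hf : HasTemperateGrowth f)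
    (i : Fin m) : HasTemperateGrowth (pDeriv i f) := by
  have hfd : HasTemperateGrowth (fderiv ℝ f) :=
    ⟨hf.1.fderiv_right (by simp), fun n => by simpa [norm_iteratedFDeriv_fderiv] using hf.2 (n + 1)⟩
  exact (ContinuousLinearMap.apply ℝ ℂ (Pi.single i 1 : Fin m → ℝ)).hasTemperateGrowth.comp hfd

lemma pDeriv_mul_inv_pow {f F : (Fin m → ℝ) → ℂ} (hf : Differentiable ℝ f)
    (hF : Differentiable ℝ F) (hf0 : ∀ x, f x ≠ 0) (i : Fin m) (N : ℕ) :
    pDeriv i (fun x => F x * (f x)⁻¹ ^ N) =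
      fun x => (pDeriv i F x * f x - N * F x * pDeriv i f x) * (f x)⁻¹ ^ (N + 1) := by
  ext x
  have h1 := (hF x).hasFDerivAt.mul
    (((hasDerivAt_inv (hf0 x)).comp_hasFDerivAt x (hf x).hasFDerivAt).pow N)
  have h2 := h1.fderiv
  simp only [pDeriv]
  refine (congrArg (fun L => L (Pi.single i 1)) h2).trans ?_
  cases N <;> simp [pow_succ] <;> field_simp [hf0 x]; ring

/-- The reciprocal of a nowhere vanishing function of temperate growth is slowly increasing as
soon as it is polynomially bounded. -/
lemma Function.HasTemperateGrowth.slowlyIncreasing_inv {f : (Fin m → ℝ) → ℂ}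
    (hf : HasTemperateGrowth f) (hf0 : ∀ x, f x ≠ 0) {k : ℕ} {C : ℝ}
    (hbound : ∀ x, ‖(f x)⁻¹‖ ≤ C * (1 + ‖x‖) ^ k) : SlowlyIncreasing (fun x => (f x)⁻¹) := by
  refine ⟨hf.1.inv hf0, fun α => ?_⟩
  obtain ⟨F, N, hF, hα⟩ : ∃ (F : (Fin m → ℝ) → ℂ) (N : ℕ), HasTemperateGrowth F ∧
      multiDeriv α (fun x => (f x)⁻¹) = fun x => F x * (f x)⁻¹ ^ N := by
    refine foldr_pDeriv_induction (p := fun g => ∃ (F : (Fin m → ℝ) → ℂ) (N : ℕ),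
      HasTemperateGrowth F ∧ g = fun x => F x * (f x)⁻¹ ^ N) ?_
      ⟨fun _ => 1, 1, .const 1, by simp⟩ α (List.finRange m)
    rintro i _ ⟨F, N, hF, rfl⟩
    refine ⟨_, N + 1, ?_, pDeriv_mul_inv_pow (hf.1.differentiable (by simp))
      (hF.1.differentiable (by simp)) hf0 i N⟩
    have := hf.pDeriv i
    have := hF.pDeriv i
    fun_prop
  obtain ⟨l, D, hD⟩ := hF.2 0
  obtain ⟨P, hP⟩ := exists_mvPolynomial_bound (m := m) (l + k * N) (|D| * C ^ N)
  refine ⟨P, fun x => le_trans ?_ (hP x)⟩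
  rw [hα, norm_mul, norm_pow, pow_add, pow_mul]
  have h1 : ‖F x‖ ≤ |D| * (1 + ‖x‖) ^ l := by
    refine le_trans (by simpa using hD x) ?_
    gcongr
    exact le_abs_self D
  calc _ ≤ |D| * (1 + ‖x‖) ^ l * (C * (1 + ‖x‖) ^ k) ^ N := by gcongr; exact hbound x
    _ = _ := by ring

end Growth

section Division

variable {m : ℕ}

lemma SchwartzMap.exists_seminorm_compSubConstCLM_le {E : Type*} [NormedAddCommGroup E]
    [NormedSpace ℝ E] (χ : 𝓢(E, ℂ)) (k l : ℕ) : ∃ C, 0 ≤ C ∧ ∀ y : E,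
      SchwartzMap.seminorm ℂ k l (χ.compSubConstCLM ℂ y) ≤ C * (1 + ‖y‖) ^ k := by
  refine ⟨2 ^ k * (Finset.Iic (k, l)).sup (fun m => SchwartzMap.seminorm ℂ m.1 m.2) χ,
    by positivity, fun y => seminorm_le_bound ℂ k l _ (by positivity) fun x => ?_⟩
  have h1 : iteratedFDeriv ℝ l (χ.compSubConstCLM ℂ y) x = iteratedFDeriv ℝ l χ (x - y) :=
    iteratedFDeriv_comp_sub l y x
  have h2 : ‖x‖ ≤ (1 + ‖y‖) * (1 + ‖x - y‖) := by
    have := norm_le_norm_add_norm_sub' x y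
    nlinarith [norm_nonneg y, norm_nonneg (x - y)]
  have h3 := one_add_le_sup_seminorm_apply (𝕜 := ℂ) (m := (k, l)) le_rfl le_rfl χ (x - y)
  rw [h1]
  calc ‖x‖ ^ k * ‖iteratedFDeriv ℝ l χ (x - y)‖
      ≤ ((1 + ‖y‖) * (1 + ‖x - y‖)) ^ k * ‖iteratedFDeriv ℝ l χ (x - y)‖ := by gcongr
    _ = (1 + ‖x - y‖) ^ k * ‖iteratedFDeriv ℝ l χ (x - y)‖ * (1 + ‖y‖) ^ k := by
      rw [mul_pow]; ring
    _ ≤ _ := by gcongr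

/-- A tempered distribution grows at most polynomially along the translates of a fixed
Schwartz function. -/
lemma SchwartzMap.exists_norm_apply_compSubConstCLM_le {E : Type*} [NormedAddCommGroup E]
    [NormedSpace ℝ E] (a : 𝓢(E, ℂ) →L[ℂ] ℂ) (χ : 𝓢(E, ℂ)) : ∃ (k : ℕ) (C : ℝ), ∀ y : E,
      ‖a (χ.compSubConstCLM ℂ y)‖ ≤ C * (1 + ‖y‖) ^ k := by
  obtain ⟨s, C, -, hC⟩ := Seminorm.bound_of_continuous (schwartz_withSeminorms ℂ E ℂ)
    ((normSeminorm ℂ ℂ).comp a.toLinearMap) (a.continuous.norm)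
  choose D hD0 hD using fun p : ℕ × ℕ => χ.exists_seminorm_compSubConstCLM_le p.1 p.2
  refine ⟨s.sup Prod.fst, C * ∑ p ∈ s, D p, fun y => ?_⟩
  refine (hC (χ.compSubConstCLM ℂ y)).trans ?_
  rw [mul_assoc]
  refine mul_le_mul_of_nonneg_left
    ((Seminorm.finset_sup_le_sum _ s (χ.compSubConstCLM ℂ y)).trans ?_) C.2
  rw [FunLike.coe_sum, Finset.sum_apply, Finset.sum_mul]
  refine Finset.sum_le_sum fun p hp => (hD p y).trans ?_
  have := hD0 p
  gcongr
  · simp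
  · exact Finset.le_sup hp

/-- Given a sequence of points, the weighted Dirac comb `g ↦ ∑ 2⁻ʲ g(xⱼ)` is a tempered
distribution. -/
lemma SchwartzMap.exists_weighted_dirac_comb {E : Type*} [NormedAddCommGroup E]
    [NormedSpace ℝ E] (x : ℕ → E) : ∃ b : 𝓢(E, ℂ) →L[ℂ] ℂ,
      ∀ g : 𝓢(E, ℂ), b g = ∑' j, (2⁻¹ : ℂ) ^ j * g (x j) := by
  let u (j : ℕ) : BoundedContinuousFunction E ℂ →L[ℂ] ℂ :=
    (2⁻¹ : ℂ) ^ j • BoundedContinuousFunction.evalCLM ℂ (x j)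
  have hu : Summable u := by
    refine Summable.of_norm_bounded (g := fun j : ℕ => (2⁻¹ : ℝ) ^ j)
      (summable_geometric_of_lt_one (by norm_num) (by norm_num)) fun j => ?_
    refine ContinuousLinearMap.opNorm_le_bound _ (by positivity) fun g => ?_
    simpa [u] using g.norm_coe_le_norm (x j)
  refine ⟨(∑' j, u j).comp (toBoundedContinuousFunctionCLM ℂ E ℂ), fun g => ?_⟩
  rw [ContinuousLinearMap.comp_apply]
  refine ((ContinuousLinearMap.apply ℂ ℂ (toBoundedContinuousFunctionCLM ℂ E ℂ g)).map_tsum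
    hu).trans ?_
  simp [u]

/-- If every tempered distribution is divisible by the nowhere vanishing smooth function `f`,
then `1 / f` is polynomially bounded. -/
lemma exists_norm_inv_le_of_forall_exists_comp {f : (Fin m → ℝ) → ℂ}
    (hf : ContDiff ℝ (⊤ : ℕ∞) f) (hf0 : ∀ x, f x ≠ 0)
    (M : 𝓢((Fin m → ℝ), ℂ) →L[ℂ] 𝓢((Fin m → ℝ), ℂ)) (hM : ∀ g x, M g x = f x * g x)
    (hdiv : ∀ b : 𝓢((Fin m → ℝ), ℂ) →L[ℂ] ℂ, ∃ a : 𝓢((Fin m → ℝ), ℂ) →L[ℂ] ℂ, a.comp M = b) :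
    ∃ (k : ℕ) (C : ℝ), ∀ x, ‖(f x)⁻¹‖ ≤ C * (1 + ‖x‖) ^ k := by
  by_contra! hcon
  have hfar (R : ℝ) (N : ℕ) : ∃ x, R ≤ ‖x‖ ∧ (1 + ‖x‖) ^ N < ‖(f x)⁻¹‖ := by
    obtain ⟨B, hB⟩ := (isCompact_closedBall (0 : Fin m → ℝ) R).exists_bound_of_continuousOn
      (hf.continuous.inv₀ hf0).continuousOn
    obtain ⟨x, hx⟩ := hcon N (max B 1)
    have h1 : (1 : ℝ) ≤ (1 + ‖x‖) ^ N := one_le_pow₀ (by simp)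
    refine ⟨x, ?_, lt_of_le_of_lt ?_ hx⟩
    · by_contra! hR
      have : ‖(f x)⁻¹‖ ≤ B := hB x (by simpa using hR.le)
      have := le_mul_of_one_le_right (le_max_of_le_right zero_le_one : 0 ≤ max B 1) h1
      linarith [le_max_left B 1]
    · exact le_mul_of_one_le_left (by positivity) (le_max_right _ _)
  choose X hXR hXN using hfar
  let x : ℕ → Fin m → ℝ := fun j => Nat.rec (X 3 0) (fun j y => X (‖y‖ + 2) (j + 1)) j
  have hstep (j : ℕ) : ‖x j‖ + 2 ≤ ‖x (j + 1)‖ := hXR _ _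
  have hmono : StrictMono fun j => ‖x j‖ := strictMono_nat_of_lt_succ fun j => by
    linarith [hstep j]
  have hx3 (j : ℕ) : 3 ≤ ‖x j‖ := (hXR 3 0).trans (hmono.monotone (Nat.zero_le j))
  have hxN (j : ℕ) : (1 + ‖x j‖) ^ j < ‖(f (x j))⁻¹‖ := by
    cases j <;> exact hXN _ _
  have hlt {i j : ℕ} (h : i < j) : ‖x i‖ + 2 ≤ ‖x j‖ :=
    (hstep i).trans (hmono.monotone h)
  have hsep {i j : ℕ} (h : i ≠ j) : 2 ≤ ‖x i - x j‖ := by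
    rcases h.lt_or_gt with h | h
    · linarith [hlt h, norm_le_norm_add_norm_sub (x i) (x j)]
    · linarith [hlt h, norm_le_norm_add_norm_sub' (x i) (x j)]
  obtain ⟨b, hb⟩ := exists_weighted_dirac_comb x
  obtain ⟨a, ha⟩ := hdiv b
  let β : ContDiffBump (0 : Fin m → ℝ) := ⟨1, 2, one_pos, one_lt_two⟩
  have hβ : ContDiff ℝ (⊤ : ℕ∞) fun y => (β y : ℂ) := Complex.ofRealCLM.contDiff.comp β.contDiff
  have hβc : HasCompactSupport fun y => (β y : ℂ) :=
    β.hasCompactSupport.comp_left (g := Complex.ofReal) rfl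
  obtain ⟨k, C, hC⟩ := exists_norm_apply_compSubConstCLM_le a (hβc.toSchwartzMap hβ)
  have key (j : ℕ) : a ((hβc.toSchwartzMap hβ).compSubConstCLM ℂ (x j)) =
      2⁻¹ ^ j * (f (x j))⁻¹ := by
    have hgc : HasCompactSupport fun y => (f y)⁻¹ * (β (y - x j) : ℂ) :=
      HasCompactSupport.mul_left (hβc.comp_homeomorph (Homeomorph.subRight (x j)))
    have hg : ContDiff ℝ (⊤ : ℕ∞) fun y => (f y)⁻¹ * (β (y - x j) : ℂ) :=
      (hf.inv hf0).mul (hβ.comp (contDiff_id.sub contDiff_const))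
    have hMg : M (hgc.toSchwartzMap hg) = (hβc.toSchwartzMap hβ).compSubConstCLM ℂ (x j) := by
      ext y
      simp [hM, hf0 y]
    rw [← hMg, ← ContinuousLinearMap.comp_apply, ha, hb, tsum_eq_single j]
    · have : β 0 = 1 := β.one_of_mem_closedBall (by simp [β])
      simp [this]
    · intro i hij
      have : β (x i - x j) = 0 := β.zero_of_le_dist (by simpa [β] using hsep hij)
      simp [this]
  have hbig (j : ℕ) : (2 : ℝ) ^ (j + k) ≤ C * 4 ^ k := by
    set t := 1 + ‖x (j + k)‖
    have ht : 4 ≤ t := by linarith [hx3 (j + k)]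
    have h1 : t ^ (j + k) ≤ 2 ^ (j + k) * (C * t ^ k) := by
      have := hC (x (j + k))
      rw [key, norm_mul, norm_pow, norm_inv, Complex.norm_ofNat, inv_pow,
        inv_mul_le_iff₀ (by positivity)] at this
      exact (hxN (j + k)).le.trans this
    have h2 : t ^ j ≤ 2 ^ (j + k) * C := by
      refine le_of_mul_le_mul_right ?_ (by positivity : 0 < t ^ k)
      rw [← pow_add]
      linarith
    have h3 : (4 : ℝ) ^ j ≤ 2 ^ (j + k) * C := le_trans (by gcongr) h2
    refine le_of_mul_le_mul_left ?_ (by positivity : (0 : ℝ) < 2 ^ (j + k))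
    calc (2 : ℝ) ^ (j + k) * 2 ^ (j + k) = 4 ^ j * 4 ^ k := by
          rw [← mul_pow, ← pow_add]; norm_num
      _ ≤ 2 ^ (j + k) * C * 4 ^ k := by gcongr
      _ = _ := by ring
  obtain ⟨j, hj⟩ := pow_unbounded_of_one_lt (C * 4 ^ k) one_lt_two
  exact (hj.trans_le ((pow_le_pow_right₀ one_le_two (Nat.le_add_right j k)).trans (hbig j))).false

end Division

/-- Let `V` be a weak-* closed subspace of `𝒮'_n`, let `e` be an 𝒮-basis of `V` (i.e. the
transpose of its associated operator `E` is injective with range `V`), and let `f` be slowly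
increasing with multiplication operator `M_f`. Then the product family `fe` (associated
operator `M_f ∘ E`) is an 𝒮-basis of `V` if and only if `f` is invertible in the ring of
slowly increasing functions, i.e. nowhere vanishing with slowly increasing reciprocal. -/
theorem mul_basis_of_closed_iff_invertible {n m : ℕ}
    (V : Submodule ℂ (𝓢((Fin n → ℝ), ℂ) →L[ℂ] ℂ))
    (hVclosed : IsClosed (show Set (WeakDual ℂ (𝓢((Fin n → ℝ), ℂ))) from
      (V : Set (𝓢((Fin n → ℝ), ℂ) →L[ℂ] ℂ))))
    (E : 𝓢((Fin n → ℝ), ℂ) →L[ℂ] 𝓢((Fin m → ℝ), ℂ))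
    (hEinj : Function.Injective
      (fun a : 𝓢((Fin m → ℝ), ℂ) →L[ℂ] ℂ => a.comp E))
    (hErange : Set.range
        (fun a : 𝓢((Fin m → ℝ), ℂ) →L[ℂ] ℂ => a.comp E) =
      (V : Set (𝓢((Fin n → ℝ), ℂ) →L[ℂ] ℂ)))
    (f : (Fin m → ℝ) → ℂ) (hf : SlowlyIncreasing f)
    (M : 𝓢((Fin m → ℝ), ℂ) →L[ℂ] 𝓢((Fin m → ℝ), ℂ))
    (hM : ∀ (g : 𝓢((Fin m → ℝ), ℂ)) (x : Fin m → ℝ), M g x = f x * g x) :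
    (Function.Injective
        (fun a : 𝓢((Fin m → ℝ), ℂ) →L[ℂ] ℂ => a.comp (M.comp E)) ∧
      Set.range
          (fun a : 𝓢((Fin m → ℝ), ℂ) →L[ℂ] ℂ => a.comp (M.comp E)) =
        (V : Set (𝓢((Fin n → ℝ), ℂ) →L[ℂ] ℂ))) ↔
      ((∀ x, f x ≠ 0) ∧ SlowlyIncreasing (fun x => (f x)⁻¹)) := by
  constructor
  · rintro ⟨hinj, hrange⟩
    have hf0 (x : Fin m → ℝ) : f x ≠ 0 := by
      intro hx
      let δ : 𝓢((Fin m → ℝ), ℂ) →L[ℂ] ℂ :=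
        (BoundedContinuousFunction.evalCLM ℂ x).comp (toBoundedContinuousFunctionCLM ℂ _ ℂ)
      have hδ (φ : 𝓢((Fin m → ℝ), ℂ)) : δ φ = φ x := rfl
      have hδ0 : δ = 0 := hinj <| ContinuousLinearMap.ext fun φ => by simp [hδ, hM, hx]
      let β : ContDiffBump x := default
      have hβc : HasCompactSupport fun y => (β y : ℂ) :=
        β.hasCompactSupport.comp_left (g := Complex.ofReal) rfl
      have hβ : ContDiff ℝ (⊤ : ℕ∞) fun y => (β y : ℂ) :=
        Complex.ofRealCLM.contDiff.comp β.contDiff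
      have := hδ (hβc.toSchwartzMap hβ)
      have hβx : β x = 1 := β.one_of_mem_closedBall (Metric.mem_closedBall_self β.rIn_pos.le)
      simp [hδ0, hβx] at this
    have hdiv (b : 𝓢((Fin m → ℝ), ℂ) →L[ℂ] ℂ) :
        ∃ a : 𝓢((Fin m → ℝ), ℂ) →L[ℂ] ℂ, a.comp M = b := by
      obtain ⟨a, ha⟩ : b.comp E ∈ Set.range fun a : 𝓢((Fin m → ℝ), ℂ) →L[ℂ] ℂ =>
          a.comp (M.comp E) := hrange ▸ hErange ▸ Set.mem_range_self b
      exact ⟨a, hEinj ha⟩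
    obtain ⟨k, C, h⟩ := exists_norm_inv_le_of_forall_exists_comp hf.1 hf0 M hM hdiv
    exact ⟨hf0, hf.hasTemperateGrowth.slowlyIncreasing_inv hf0 h⟩
  · rintro ⟨hf0, hinv⟩
    have hg := hinv.hasTemperateGrowth
    have hMN (a : 𝓢((Fin m → ℝ), ℂ) →L[ℂ] ℂ) :
        (a.comp M).comp (smulLeftCLM ℂ fun x => (f x)⁻¹) = a := by
      ext φ
      refine congrArg a (SchwartzMap.ext fun x => ?_)
      simp [hM, smulLeftCLM_apply_apply hg, hf0 x]
    have hNM (a : 𝓢((Fin m → ℝ), ℂ) →L[ℂ] ℂ) :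
        (a.comp (smulLeftCLM ℂ fun x => (f x)⁻¹)).comp M = a := by
      ext φ
      refine congrArg a (SchwartzMap.ext fun x => ?_)
      simp [hM, smulLeftCLM_apply_apply hg, hf0 x]
    refine ⟨fun a b hab => ?_, ?_⟩
    · have : a.comp M = b.comp M := hEinj hab
      rw [← hMN a, this, hMN b]
    · rw [← hErange]
      refine Set.Subset.antisymm ?_ ?_
      · rintro _ ⟨a, rfl⟩
        exact ⟨a.comp M, rfl⟩
      · rintro _ ⟨a, rfl⟩
        refine ⟨a.comp (smulLeftCLM ℂ fun x => (f x)⁻¹), ?_⟩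
        exact congrArg (fun a => a.comp E) (hNM a)
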